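/- Let S be a finite lattice and let G : S^ℤ → S^ℤ be a lattice-linear cellular automaton, i.e., a block map that is a lattice homomorphism for the cellwise operations on S^ℤ. Then: (a) G is stable, i.e., there exists q ∈ ℕ with G^{q+1}(S^ℤ) = G^q(S^ℤ), so the limit set X = ⋂_{n} G^n(S^ℤ) equals G^q(S^ℤ); (b) there exist m ∈ ℕ, finite lattices R_1, …, R_m, integers k_1, …, k_m, a positive integer p, and a bijection φ : X → R_1^ℤ × ⋯ × R_m^ℤ that is a homeomorphism, commutes with the shift (acting as σ on each factor), is a lattice isomorphism onto the product with componentwise cellwise operations, and satisfies φ(G^p(x))_i = σ^{k_i}(φ(x)_i) for all x ∈ X and all i; in particular X is algebraically conjugate to a product of full shifts and G^p restricted to X corresponds to a product of powers of shift maps. -/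

import Mathlib

/-- The shift map on the full shift `ℤ → α`. -/
def shiftMap {α : Type*} (x : ℤ → α) : ℤ → α := fun i => x (i + 1)

/-- A map `F` out of a set `X` of configurations has radius at most `r`. -/
def HasRadius1 {α β : Type*} (X : Set (ℤ → α)) (F : (ℤ → α) → ℤ → β) (r : ℕ) : Prop :=
  ∀ x ∈ X, ∀ y ∈ X, ∀ i : ℤ, (∀ j : ℤ, |j - i| ≤ (r : ℤ) → x j = y j) → F x i = F y i

/-- Conjugacy data for the limit set `X` of a lattice-linear CA `G`: a shift-commuting
bijection `φ` of `X` with the product of full shifts `R₁^ℤ × ⋯ × R_m^ℤ` which is a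
lattice isomorphism (for the componentwise cellwise operations); `φ` and its inverse
`ψ` are block maps, and `G^p` on `X` corresponds via `φ` to the product of the shift
powers `σ^{k_l}`. -/
def LimitConjugacyData {S : Type*} [Lattice S] (X : Set (ℤ → S))
    (G : (ℤ → S) → (ℤ → S)) {m : ℕ} (R : Fin m → Type) [∀ l, Lattice (R l)]
    (k : Fin m → ℤ) (p : ℕ) : Prop :=
  ∃ (φ : (ℤ → S) → ∀ l, ℤ → R l) (ψ : (∀ l, ℤ → R l) → (ℤ → S)),
    Set.BijOn φ X Set.univ ∧
    (∀ x ∈ X, ψ (φ x) = x) ∧ (∀ z : ∀ l, ℤ → R l, ψ z ∈ X ∧ φ (ψ z) = z) ∧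
    (∃ r : ℕ, ∀ x ∈ X, ∀ y ∈ X, ∀ (l : Fin m) (i : ℤ),
      (∀ jj : ℤ, |jj - i| ≤ (r : ℤ) → x jj = y jj) → φ x l i = φ y l i) ∧
    (∃ r : ℕ, ∀ z w : ∀ l, ℤ → R l, ∀ i : ℤ,
      (∀ (l : Fin m) (jj : ℤ), |jj - i| ≤ (r : ℤ) → z l jj = w l jj) → ψ z i = ψ w i) ∧
    (∀ x ∈ X, φ (shiftMap x) = fun l => shiftMap (φ x l)) ∧
    (∀ x ∈ X, ∀ y ∈ X, φ (fun i => x i ⊓ y i) = fun l i => φ x l i ⊓ φ y l i) ∧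
    (∀ x ∈ X, ∀ y ∈ X, φ (fun i => x i ⊔ y i) = fun l i => φ x l i ⊔ φ y l i) ∧
    (∀ x ∈ X, φ (G^[p] x) = fun l i => φ x l (i + k l))

/-- Two elements `u`, `v` of a lattice such that `r ↦ (r ⊓ u, r ⊓ v)` and `(a, b) ↦ a ⊔ b` are
inverse to each other and split the lattice as the product of `Iic u` and `Iic v`. -/
structure IsDirectPair {L : Type*} [Lattice L] (u v : L) : Prop where
  inf_sup_inf : ∀ r, (r ⊓ u) ⊔ (r ⊓ v) = r
  sup_inf_left : ∀ a ≤ u, ∀ b ≤ v, (a ⊔ b) ⊓ u = a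
  sup_inf_right : ∀ a ≤ u, ∀ b ≤ v, (a ⊔ b) ⊓ v = b

/-- A lattice without nontrivial decompositions as a product of two lattices. -/
def DirectlyIndecomposable (L : Type*) [Lattice L] : Prop :=
  ∀ u v : L, IsDirectPair u v → IsBot u ∨ IsBot v

namespace IsDirectPair

variable {L : Type*} [Lattice L] {u v : L}

theorem symm (h : IsDirectPair u v) : IsDirectPair v u where
  inf_sup_inf r := by rw [sup_comm, h.inf_sup_inf]
  sup_inf_left a ha b hb := by rw [sup_comm, h.sup_inf_right b hb a ha]
  sup_inf_right a ha b hb := by rw [sup_comm, h.sup_inf_left b hb a ha]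

/-- The product decomposition given by a direct pair. -/
def orderIso (h : IsDirectPair u v) : L ≃o Set.Iic u × Set.Iic v where
  toFun r := (⟨r ⊓ u, inf_le_right⟩, ⟨r ⊓ v, inf_le_right⟩)
  invFun p := p.1 ⊔ p.2
  left_inv r := h.inf_sup_inf r
  right_inv p := Prod.ext (Subtype.ext (h.sup_inf_left _ p.1.2 _ p.2.2))
    (Subtype.ext (h.sup_inf_right _ p.1.2 _ p.2.2))
  map_rel_iff' := by
    intro r s
    refine ⟨fun hrs => ?_, fun hrs => ⟨inf_le_inf_right u hrs, inf_le_inf_right v hrs⟩⟩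
    rw [← h.inf_sup_inf r]
    exact sup_le (le_trans hrs.1 inf_le_left) (le_trans hrs.2 inf_le_left)

theorem card_Iic_lt [Finite L] (h : IsDirectPair u v) (hv : ¬ IsBot v) :
    Nat.card (Set.Iic u) < Nat.card L := by
  rw [← Set.ncard_univ L, Nat.card_coe_set_eq]
  refine Set.ncard_lt_ncard (Set.ssubset_univ_iff.2 fun hu => hv fun r => ?_)
  have hvu : v ≤ u := by simpa using hu.ge (Set.mem_univ v)
  have := h.sup_inf_right v hvu (r ⊓ v) inf_le_right
  rw [sup_eq_left.2 inf_le_right, inf_idem] at this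
  exact inf_eq_right.1 this.symm

end IsDirectPair

theorem exists_orderIso_pi_directlyIndecomposable (T : Type) [Lattice T] [Finite T] [Nonempty T] :
    ∃ (ι : Type) (_ : Finite ι) (R : ι → Type) (_ : ∀ i, Lattice (R i)),
      (∀ i, Finite (R i)) ∧ (∀ i, Nontrivial (R i)) ∧ (∀ i, DirectlyIndecomposable (R i)) ∧
      Nonempty (T ≃o ∀ i, R i) := by
  induction hn : Nat.card T using Nat.strong_induction_on generalizing T with
  | _ n ih =>
  subst hn
  rcases subsingleton_or_nontrivial T with hT | hT
  · refine ⟨Empty, inferInstance, fun _ => Unit, fun _ => inferInstance, nofun, nofun, nofun, ⟨?_⟩⟩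
    have : Unique T := uniqueOfSubsingleton (Classical.arbitrary T)
    exact ⟨Equiv.ofUnique _ _, by
      intro a b
      simp [Subsingleton.elim a b]⟩
  by_cases hI : DirectlyIndecomposable T
  · exact ⟨Unit, inferInstance, fun _ => T, fun _ => inferInstance, fun _ => inferInstance,
      fun _ => hT, fun _ => hI, ⟨(OrderIso.funUnique Unit T).symm⟩⟩
  simp only [DirectlyIndecomposable, not_forall, not_or] at hI
  obtain ⟨u, v, h, hu, hv⟩ := hI
  obtain ⟨ι, _, R, iR, hf, hn, hi, ⟨e⟩⟩ := ih _ (h.card_Iic_lt hv) (Set.Iic u) rfl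
  obtain ⟨κ, _, Q, iQ, hf', hn', hi', ⟨e'⟩⟩ := ih _ (h.symm.card_Iic_lt hu) (Set.Iic v) rfl
  let P : ι ⊕ κ → Type := Sum.elim R Q
  let inst : ∀ c, Lattice (P c) := fun c => match c with
    | .inl i => iR i
    | .inr i => iQ i
  refine ⟨ι ⊕ κ, inferInstance, P, inst, fun c => ?_, fun c => ?_, fun c => ?_, ⟨?_⟩⟩
  · cases c
    exacts [hf _, hf' _]
  · cases c
    exacts [hn _, hn' _]
  · cases c
    exacts [hi _, hi' _]
  · have s : (∀ c, P c) ≃o (∀ i, R i) × (∀ i, Q i) :=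
      { Equiv.sumPiEquivProdPi P with
        map_rel_iff' := by
          intro a b
          exact ⟨fun hab c => match c with
            | .inl i => hab.1 i
            | .inr i => hab.2 i, fun hab => ⟨fun i => hab _, fun i => hab _⟩⟩ }
    have t : Set.Iic u × Set.Iic v ≃o (∀ i, R i) × (∀ i, Q i) :=
      { e.toEquiv.prodCongr e'.toEquiv with
        map_rel_iff' := and_congr e.map_rel_iff e'.map_rel_iff }
    exact h.orderIso.trans (t.trans s.symm)

theorem exists_quotient_by_ker {S L : Type*} [Lattice S] [Finite S] [Lattice L]
    (H : LatticeHom S L) :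
    ∃ (T : Type) (_ : Lattice T) (_ : Finite T) (π : LatticeHom S T),
      Function.Surjective π ∧ ∀ a b, π a = π b ↔ H a = H b := by
  let M := Sublattice.LatticeHom.range H
  have : Finite M := Set.finite_range H
  let e := Finite.equivFin M
  let π : S → M := fun a => ⟨H a, a, rfl⟩
  refine ⟨Fin (Nat.card M), e.symm.lattice, inferInstance,
    @LatticeHom.mk _ _ _ e.symm.lattice
      (@SupHom.mk _ _ _ (e.symm.lattice).toMax (fun a => e (π a)) ?_) ?_, ?_, ?_⟩
  · intro a b
    refine congrArg e (Subtype.ext ?_)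
    simp [π, e]
  · intro a b
    refine congrArg e (Subtype.ext ?_)
    simp [π]
  · refine e.surjective.comp ?_
    rintro ⟨_, a, rfl⟩
    exact ⟨a, rfl⟩
  · intro a b
    exact e.injective.eq_iff.trans Subtype.ext_iff

theorem exists_surjective_hom_pi_directlyIndecomposable {S L : Type*} [Lattice S] [Finite S]
    [Nonempty S] [Lattice L] (H : LatticeHom S L) :
    ∃ (m : ℕ) (R : Fin m → Type) (_ : ∀ l, Lattice (R l)) (P : LatticeHom S (∀ l, R l)),
      (∀ l, Finite (R l)) ∧ (∀ l, Nontrivial (R l)) ∧ (∀ l, DirectlyIndecomposable (R l)) ∧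
      Function.Surjective P ∧ ∀ a b, P a = P b ↔ H a = H b := by
  obtain ⟨T, _, _, π, hπ, hker⟩ := exists_quotient_by_ker H
  have : Nonempty T := Nonempty.map π inferInstance
  obtain ⟨ι, _, R, _, hf, hn, hi, ⟨e⟩⟩ := exists_orderIso_pi_directlyIndecomposable T
  let ε := Finite.equivFin ι
  let E : T ≃ ∀ l, R (ε.symm l) := e.toEquiv.trans (Equiv.piCongrLeft' R ε)
  refine ⟨Nat.card ι, fun l => R (ε.symm l), fun l => inferInstance,
    ⟨⟨fun a => E (π a), fun a b => ?_⟩, fun a b => ?_⟩, fun l => hf _, fun l => hn _,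
    fun l => hi _, E.surjective.comp hπ, fun a b => E.injective.eq_iff.trans (hker a b)⟩
  · ext l
    simp [E]
  · ext l
    simp [E]

section Update

variable {C : Type*} [DecidableEq C] {A : C → Type*} [∀ c, Lattice (A c)]
  [∀ c, BoundedOrder (A c)]

theorem inf_update_bot_top (x : ∀ c, A c) (c : C) :
    x ⊓ Function.update ⊥ c ⊤ = Function.update ⊥ c (x c) := by
  ext d
  by_cases h : d = c
  · subst h; simp
  · simp [h]

theorem inf_update_top_bot (x : ∀ c, A c) (c : C) :
    x ⊓ Function.update ⊤ c ⊥ = Function.update x c ⊥ := by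
  ext d
  by_cases h : d = c
  · subst h; simp
  · simp [h]

theorem update_bot_sup_update (z : ∀ c, A c) (c : C) (a : A c) :
    Function.update ⊥ c a ⊔ Function.update z c ⊥ = Function.update z c a := by
  ext d
  by_cases h : d = c
  · subst h; simp
  · simp [h]

variable {L : Type*} [Lattice L] (f : LatticeHom (∀ c, A c) L)

theorem isDirectPair_of_surjective (hf : Function.Surjective f) (c : C) :
    IsDirectPair (f (Function.update ⊥ c ⊤)) (f (Function.update ⊤ c ⊥)) where
  inf_sup_inf r := by
    obtain ⟨x, rfl⟩ := hf r
    rw [← map_inf, ← map_inf, ← map_sup, inf_update_bot_top, inf_update_top_bot,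
      update_bot_sup_update, Function.update_eq_self]
  sup_inf_left a ha b hb := by
    obtain ⟨x, rfl⟩ := hf a
    obtain ⟨y, rfl⟩ := hf b
    rw [← inf_eq_left.2 ha, ← inf_eq_left.2 hb, ← map_inf, ← map_inf, ← map_sup, ← map_inf,
      inf_update_bot_top x, inf_update_top_bot, update_bot_sup_update, inf_update_bot_top,
      Function.update_self]
  sup_inf_right a ha b hb := by
    obtain ⟨x, rfl⟩ := hf a
    obtain ⟨y, rfl⟩ := hf b
    rw [← inf_eq_left.2 ha, ← inf_eq_left.2 hb, ← map_inf, ← map_inf, ← map_sup, ← map_inf,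
      inf_update_bot_top, inf_update_top_bot y, update_bot_sup_update, inf_update_top_bot,
      Function.update_idem]

/-- If `f` identifies `a` and `b` placed at `c` on the bottom configuration, then it identifies
them on any configuration. -/
theorem map_update_eq_of_map_update_bot_eq {c : C} {a b : A c}
    (h : f (Function.update ⊥ c a) = f (Function.update ⊥ c b)) (z : ∀ c, A c) :
    f (Function.update z c a) = f (Function.update z c b) := by
  rw [← update_bot_sup_update z c a, ← update_bot_sup_update z c b, map_sup, map_sup, h]

theorem map_piecewise_eq (W : Finset C) (x y : ∀ c, A c)
    (h : ∀ c ∈ W, f (Function.update ⊥ c (x c)) = f (Function.update ⊥ c (y c))) :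
    f (W.piecewise x y) = f y := by
  induction W using Finset.induction_on with
  | empty => simp
  | insert c W _ ih =>
    rw [Finset.piecewise_insert,
      map_update_eq_of_map_update_bot_eq f (h c (Finset.mem_insert_self c W)), ← ih fun d hd =>
      h d (Finset.mem_insert_of_mem hd)]
    by_cases hc : c ∈ W
    · rw [map_update_eq_of_map_update_bot_eq f (h c (Finset.mem_insert_self c W)).symm]
      congr 1
      rw [Function.update_eq_self_iff]
      simp [hc]
    · congr 1
      rw [Function.update_eq_self_iff]
      simp [hc]

theorem DirectlyIndecomposable.exists_coordinate [Nontrivial L] (hL : DirectlyIndecomposable L)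
    (hf : Function.Surjective f) (W : Finset C)
    (hW : ∀ x y, (∀ c ∈ W, x c = y c) → f x = f y) :
    ∃ c, ∀ x y, x c = y c → f x = f y := by
  by_cases h : ∃ c, IsBot (f (Function.update ⊤ c ⊥))
  · obtain ⟨c, hc⟩ := h
    have key : ∀ x, f x = f (Function.update ⊥ c (x c)) := fun x => by
      have := (isDirectPair_of_surjective f hf c).inf_sup_inf (f x)
      rw [inf_eq_right.2 (hc _), sup_eq_left.2 (hc _), ← map_inf, inf_update_bot_top] at this
      exact this.symm
    exact ⟨c, fun x y hxy => by rw [key x, key y, hxy]⟩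
  · exfalso
    push Not at h
    have hbot : ∀ x, f ⊥ ≤ f x := fun x => OrderHomClass.mono f bot_le
    have htop : ∀ x, f x ≤ f ⊤ := fun x => OrderHomClass.mono f le_top
    have h1 : f (W.piecewise ⊤ ⊥) = f ⊥ := map_piecewise_eq f W _ _ fun c _ => by
      have := (hL _ _ (isDirectPair_of_surjective f hf c)).resolve_right (h c)
      have h2 : f (Function.update ⊥ c (⊤ : A c)) = f ⊥ := le_antisymm (this _) (hbot _)
      simpa [Function.update_eq_self] using h2.trans (congrArg f (Function.update_eq_self c ⊥).symm)
    have h2 : f (W.piecewise ⊤ ⊥) = f ⊤ := hW _ _ fun c hc => by simp [hc]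
    obtain ⟨a, b, hab⟩ := exists_pair_ne L
    obtain ⟨x, rfl⟩ := hf a
    obtain ⟨y, rfl⟩ := hf b
    have key : ∀ x, f x = f ⊥ := fun x => le_antisymm ((htop x).trans (h2.symm.trans h1).le) (hbot x)
    exact hab ((key x).trans (key y).symm)

end Update

theorem exists_iterate_eq_id {α : Type*} [Finite α] {f : α → α} (hf : Function.Injective f) :
    ∃ n, 0 < n ∧ f^[n] = id := by
  let e : Equiv.Perm α := Equiv.ofBijective f ⟨hf, Finite.surjective_of_injective hf⟩
  refine ⟨orderOf e, orderOf_pos e, ?_⟩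
  have := congrArg (fun g : Equiv.Perm α => (g : α → α)) (pow_orderOf_eq_one e)
  rwa [Equiv.Perm.coe_pow] at this

section Automaton

variable {α β : Type*}

theorem map_shift_add {F : (ℤ → α) → ℤ → β} (hF : ∀ x, F (shiftMap x) = shiftMap (F x)) (n : ℤ)
    (x : ℤ → α) : F (fun i => x (i + n)) = fun i => F x (i + n) := by
  induction n using Int.induction_on generalizing x with
  | zero => simp
  | succ n ih =>
    have h := ih (shiftMap x)
    rw [hF] at h
    simpa only [shiftMap, add_assoc] using h
  | pred n ih =>
    have h := ih fun i => x (i - 1)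
    have h' := hF fun i => x (i - 1)
    have hx : (shiftMap fun i => x (i - 1)) = x := by
      ext i
      simp [shiftMap]
    rw [hx] at h'
    simp only [← add_sub_assoc]
    rw [h]
    ext i
    rw [h', shiftMap, sub_add_cancel]

theorem map_apply_eq_map_shift {F : (ℤ → α) → ℤ → β}
    (hF : ∀ x, F (shiftMap x) = shiftMap (F x)) (x : ℤ → α) (n : ℤ) :
    F x n = F (fun i => x (i + n)) 0 := by
  simp [map_shift_add hF]

theorem hasRadius1_iterate {F : (ℤ → α) → ℤ → α} {r : ℕ} (hF : HasRadius1 Set.univ F r) (n : ℕ) :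
    HasRadius1 Set.univ F^[n] (n * r) := by
  induction n with
  | zero =>
    intro x _ y _ i h
    exact h i (by simp)
  | succ n ih =>
    intro x _ y _ i h
    rw [Function.iterate_succ_apply, Function.iterate_succ_apply]
    refine ih _ trivial _ trivial i fun j hj => hF _ trivial _ trivial j fun l hl => h l ?_
    push_cast at hj ⊢
    have := abs_sub_le l j i
    linarith

end Automaton

section Injective

variable {ι : Type*} [Finite ι] {R : ι → Type*} [∀ i, Lattice (R i)] [∀ i, Finite (R i)]
  [∀ i, Nontrivial (R i)]

theorem exists_apply_eq_of_injective (hR : ∀ i, DirectlyIndecomposable (R i))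
    (F : LatticeHom (ℤ → ∀ i, R i) (ℤ → ∀ i, R i)) {r : ℕ} (hr : HasRadius1 Set.univ F r)
    (hs : ∀ x, F (shiftMap x) = shiftMap (F x)) (hF : Function.Injective F) (i : ι) :
    ∃ (j : ι) (h : R j → R i) (k : ℤ), Function.Surjective h ∧
      ∀ x n, F x n i = h (x (n + k) j) := by
  classical
  have := Fintype.ofFinite ι
  let _ : ∀ i, BoundedOrder (R i) := fun i =>
    have := Fintype.ofFinite (R i)
    Fintype.toBoundedOrder (R i)
  have hconst : ∀ (b : ∀ i, R i) n, F (fun _ => b) n = F (fun _ => b) 0 := fun b n =>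
    map_apply_eq_map_shift hs _ n
  have hsurj : Function.Surjective fun b : ∀ i, R i => F (fun _ => b) 0 :=
    Finite.surjective_of_injective fun b b' h => by
      refine congrFun (hF (a₁ := fun _ => b) (a₂ := fun _ => b') (funext fun n => ?_)) 0
      rw [hconst b, hconst b']
      exact h
  let curry (x : ∀ c : ι × ℤ, R c.1) : ℤ → ∀ j, R j := fun n j => x (j, n)
  let f : LatticeHom (∀ c : ι × ℤ, R c.1) (R i) :=
    { toFun := fun x => F (curry x) 0 i
      map_sup' := fun x y => congrFun (congrFun (F.map_sup' (curry x) (curry y)) 0) i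
      map_inf' := fun x y => congrFun (congrFun (F.map_inf' (curry x) (curry y)) 0) i }
  have hf : ∀ x : ℤ → ∀ i, R i, f (fun c => x c.2 c.1) = F x 0 i := fun x => rfl
  have hfs : Function.Surjective f := fun a => by
    obtain ⟨b, hb⟩ := hsurj (Function.update ⊥ i a)
    refine ⟨fun c => b c.1, (hf fun _ => b).trans ?_⟩
    simpa using congrFun hb i
  obtain ⟨⟨j, k⟩, hc⟩ := (hR i).exists_coordinate f hfs
    (Finset.univ ×ˢ Finset.Icc (-r : ℤ) r) fun x y hxy => by
      refine congrFun (hr _ trivial _ trivial 0 fun n hn => funext fun j => hxy (j, n) ?_) i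
      rw [sub_zero, abs_le] at hn
      simpa using hn
  let h : R j → R i := fun a => F (fun _ => Function.update ⊥ j a) 0 i
  have hh : ∀ x, F x 0 i = h (x k j) := fun x => by
    rw [← hf, hc _ (fun c => Function.update (⊥ : ∀ i, R i) j (x k j) c.1) (by simp)]
    rfl
  refine ⟨j, h, k, fun a => ?_, fun x n => ?_⟩
  · obtain ⟨x, rfl⟩ := hfs a
    exact ⟨x (j, k), (hh fun n j => x (j, n)).symm⟩
  · rw [map_apply_eq_map_shift hs, hh, add_comm]

/-- An injective lattice-linear automaton on a product of full shifts over indecomposable lattices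
has a power which is a product of shifts. -/
theorem exists_iterate_eq_shift (hR : ∀ i, DirectlyIndecomposable (R i))
    (F : LatticeHom (ℤ → ∀ i, R i) (ℤ → ∀ i, R i)) {r : ℕ} (hr : HasRadius1 Set.univ F r)
    (hs : ∀ x, F (shiftMap x) = shiftMap (F x)) (hF : Function.Injective F) :
    ∃ (k : ι → ℤ) (p : ℕ), 0 < p ∧ ∀ x, F^[p] x = fun n i => x (n + k i) i := by
  classical
  choose π h k hsurj hFx using exists_apply_eq_of_injective hR F hr hs hF
  have hπ : Function.Surjective π := fun j => by
    by_contra! hj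
    obtain ⟨z⟩ : Nonempty (∀ i, R i) := inferInstance
    obtain ⟨a, b, hab⟩ := exists_pair_ne (R j)
    have hz := @hF (fun _ => Function.update z j a) (fun _ => Function.update z j b)
      (funext fun n => funext fun i => by simp [hFx, hj i])
    simpa [hab] using congrFun (congrFun hz 0) j
  obtain ⟨n, hn, hπn⟩ := exists_iterate_eq_id (Finite.injective_iff_surjective.2 hπ)
  have hiter : ∀ n i j, π^[n] i = j → ∃ (g : R j → R i) (l : ℤ), Function.Surjective g ∧
      ∀ x m, F^[n] x m i = g (x (m + l) j) := fun n => by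
    induction n with
    | zero =>
      rintro i _ rfl
      exact ⟨id, 0, Function.surjective_id, by simp⟩
    | succ n ih =>
      rintro i _ rfl
      rw [Function.iterate_succ_apply']
      obtain ⟨g, l, hg, hgx⟩ := ih i _ rfl
      refine ⟨g ∘ h _, l + k (π^[n] i), hg.comp (hsurj _), fun x m => ?_⟩
      rw [Function.iterate_succ_apply, hgx, hFx, Function.comp_apply, add_assoc]
  choose g l hg hgx using fun i => hiter n i i (congrFun hπn i)
  obtain ⟨t, ht, hgt⟩ := exists_iterate_eq_id
    (Finite.injective_iff_surjective.2 (Function.Surjective.piMap hg))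
  have hgi : ∀ t x m i, F^[n * t] x m i = (g i)^[t] (x (m + t * l i) i) := fun t => by
    induction t with
    | zero => simp
    | succ t ih =>
      intro x m i
      rw [Nat.mul_succ, Function.iterate_add_apply, ih, hgx, Function.iterate_succ_apply]
      push_cast
      ring_nf
  refine ⟨fun i => t * l i, n * t, Nat.mul_pos hn ht, fun x => funext fun m => funext fun i => ?_⟩
  rw [hgi]
  rw [Pi.map_iterate] at hgt
  exact congrFun (congrFun hgt fun i => x (m + t * l i) i) i

end Injective

section Kernel

variable {S : Type*} [Lattice S] [BoundedOrder S] {H : LatticeHom (ℤ → S) (ℤ → S)}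

theorem map_update_bot_eq_iff (hs : ∀ x, H (shiftMap x) = shiftMap (H x)) (i : ℤ) (a b : S) :
    H (Function.update ⊥ i a) = H (Function.update ⊥ i b) ↔
      H (Function.update ⊥ 0 a) = H (Function.update ⊥ 0 b) := by
  have key : ∀ a : S, (fun j => (Function.update ⊥ i a : ℤ → S) (j + i)) =
      Function.update ⊥ 0 a := fun a => by
    ext j
    by_cases hj : j = 0
    · simp [hj]
    · simp [hj]
  have hinj : Function.Injective fun (x : ℤ → S) j => x (j + i) := fun x y hxy => by
    ext j
    simpa using congrFun hxy (j - i)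
  rw [← key a, ← key b, map_shift_add hs, map_shift_add hs]
  exact hinj.eq_iff.symm

theorem map_eq_of_forall_update {r : ℕ} (hr : HasRadius1 Set.univ H r)
    (hs : ∀ x, H (shiftMap x) = shiftMap (H x)) {x y : ℤ → S}
    (h : ∀ i, H (Function.update ⊥ 0 (x i)) = H (Function.update ⊥ 0 (y i))) : H x = H y := by
  ext n
  rw [← map_piecewise_eq H (Finset.Icc (n - r) (n + r)) x y
    fun i _ => (map_update_bot_eq_iff hs i _ _).2 (h i)]
  refine hr _ trivial _ trivial n fun j hj => ?_
  rw [abs_le] at hj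
  rw [Finset.piecewise_eq_of_mem]
  rw [Finset.mem_Icc]
  constructor <;> linarith

theorem map_update_eq_of_forall_eq {r : ℕ} (hr : HasRadius1 Set.univ H r)
    (hs : ∀ x, H (shiftMap x) = shiftMap (H x)) {x y : ℤ → S} {i : ℤ}
    (h : ∀ j : ℤ, |j - i| ≤ r → H x j = H y j) :
    H (Function.update ⊥ 0 (x i)) = H (Function.update ⊥ 0 (y i)) := by
  rw [← map_update_bot_eq_iff hs i]
  ext j
  by_cases hj : |j - i| ≤ r
  · rw [← inf_update_bot_top, ← inf_update_bot_top, map_inf, map_inf, Pi.inf_apply, Pi.inf_apply,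
      h j hj]
  · refine hr _ trivial _ trivial j fun l hl => ?_
    have hli : l ≠ i := by
      rintro rfl
      exact hj (by rwa [abs_sub_comm])
    simp [hli]

/-- The iterates of a lattice endomorphism. -/
def LatticeHom.iterate {L : Type*} [Lattice L] (G : LatticeHom L L) (n : ℕ) : LatticeHom L L where
  toFun := G^[n]
  map_sup' := by
    induction n with
    | zero => simp
    | succ n ih => simp [ih]
  map_inf' := by
    induction n with
    | zero => simp
    | succ n ih => simp [ih]

end Kernel

theorem stable_and_conjugate_of_isEmpty {S : Type*} [IsEmpty S] [Lattice S]
    (G : (ℤ → S) → (ℤ → S)) :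
    ∃ q : ℕ,
      Set.range (G^[q + 1]) = Set.range (G^[q]) ∧
      (⋂ n : ℕ, Set.range (G^[n])) = Set.range (G^[q]) ∧
      ∃ (m : ℕ) (R : Fin m → Type) (_ : ∀ l, Fintype (R l)) (iL : ∀ l, Lattice (R l))
        (k : Fin m → ℤ) (p : ℕ), 0 < p ∧
        @LimitConjugacyData S _ (⋂ n : ℕ, Set.range (G^[n])) G m R iL k p := by
  refine ⟨0, Subsingleton.elim _ _, Subsingleton.elim _ _, 1, fun _ => Empty,
    fun _ => inferInstance, fun _ => inferInstance, 0, 1, one_pos,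
    isEmptyElim, fun z => isEmptyElim (z 0 0), ?_, isEmptyElim, fun z => isEmptyElim (z 0 0),
    ⟨0, isEmptyElim⟩, ⟨0, fun z => isEmptyElim (z 0 0)⟩, isEmptyElim, isEmptyElim, isEmptyElim,
    isEmptyElim⟩
  exact ⟨isEmptyElim, isEmptyElim, fun z => isEmptyElim (z 0 0)⟩

section Conjugacy

variable {S : Type*} [Lattice S]

theorem limitConjugacyData_of_semiconj {G : (ℤ → S) → (ℤ → S)} {m : ℕ} {R : Fin m → Type}
    [∀ l, Lattice (R l)] [∀ l, Nonempty (R l)] {Ψ : LatticeHom (ℤ → ∀ l, R l) (ℤ → S)}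
    {F : (ℤ → ∀ l, R l) → ℤ → ∀ l, R l} (hΨF : Function.Semiconj Ψ F G) {r : ℕ}
    (hΨr : HasRadius1 Set.univ Ψ r) (hΨs : ∀ t, Ψ (shiftMap t) = shiftMap (Ψ t))
    (hΨinj : ∀ t t' i, (∀ j : ℤ, |j - i| ≤ (r : ℤ) → Ψ t j = Ψ t' j) → t i = t' i)
    {k : Fin m → ℤ} {p : ℕ} (hF : ∀ t, F^[p] t = fun n l => t (n + k l) l) :
    LimitConjugacyData (Set.range Ψ) G R k p := by
  have hinj : Function.Injective Ψ := fun t t' h =>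
    funext fun i => hΨinj t t' i fun j _ => congrFun h j
  obtain ⟨Φ, hΦ⟩ := hinj.hasLeftInverse
  refine ⟨fun x l i => Φ x i l, fun z => Ψ fun i l => z l i, ?_, ?_, fun z => ⟨⟨_, rfl⟩, ?_⟩,
    ⟨r, ?_⟩, ⟨r, fun z w i h => ?_⟩, ?_, ?_, ?_, ?_⟩
  · refine ⟨Set.mapsTo_univ _ _, ?_, fun z _ => ⟨Ψ fun i l => z l i, ⟨_, rfl⟩, ?_⟩⟩
    · rintro _ ⟨t, rfl⟩ _ ⟨t', rfl⟩ h
      simp only [hΦ t, hΦ t'] at h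
      exact congrArg Ψ (funext fun i => funext fun l => congrFun (congrFun h l) i)
    · simp only [hΦ _]
  · rintro _ ⟨t, rfl⟩
    simp only [hΦ t]
  · simp only [hΦ _]
  · rintro _ ⟨t, rfl⟩ _ ⟨t', rfl⟩ l i h
    simp only [hΦ _]
    rw [hΨinj t t' i h]
  · exact hΨr _ trivial _ trivial i fun j hj => funext fun l => h l j hj
  · rintro _ ⟨t, rfl⟩
    simp only [← hΨs, hΦ _]
    rfl
  · rintro _ ⟨t, rfl⟩ _ ⟨t', rfl⟩
    have h : (fun i => Ψ t i ⊓ Ψ t' i) = Ψ (t ⊓ t') := (map_inf Ψ t t').symm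
    simp only [h, hΦ _]
    rfl
  · rintro _ ⟨t, rfl⟩ _ ⟨t', rfl⟩
    have h : (fun i => Ψ t i ⊔ Ψ t' i) = Ψ (t ⊔ t') := (map_sup Ψ t t').symm
    simp only [h, hΦ _]
    rfl
  · rintro _ ⟨t, rfl⟩
    rw [← hΨF.iterate_right p t]
    simp only [hΦ _, hF]

variable [Finite S] [BoundedOrder S] (G : LatticeHom (ℤ → S) (ℤ → S))

theorem exists_iterate_ker_stable :
    ∃ q, ∀ a b : S, G.iterate (q + 1) (Function.update ⊥ 0 a) =
      G.iterate (q + 1) (Function.update ⊥ 0 b) →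
      G.iterate q (Function.update ⊥ 0 a) = G.iterate q (Function.update ⊥ 0 b) := by
  let θ : ℕ →o Set (S × S) :=
    { toFun := fun n =>
        {p | G^[n] (Function.update ⊥ 0 p.1) = G^[n] (Function.update ⊥ 0 p.2)}
      monotone' := monotone_nat_of_le_succ fun n p hp => by
        simp only [Set.mem_ofPred_eq, Function.iterate_succ_apply'] at hp ⊢
        rw [hp] }
  obtain ⟨q, hq⟩ := WellFoundedGT.monotone_chain_condition θ
  exact ⟨q, fun a b h => (hq (q + 1) q.le_succ).ge (show (a, b) ∈ θ (q + 1) from h)⟩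

end Conjugacy

theorem iInter_range_iterate_eq {α : Type*} {G : α → α} {q : ℕ}
    (h : ∀ n, Set.range G^[q] ⊆ Set.range G^[n]) :
    Set.range G^[q + 1] = Set.range G^[q] ∧ ⋂ n, Set.range G^[n] = Set.range G^[q] := by
  refine ⟨(h _).antisymm' ?_, (Set.iInter_subset _ q).antisymm (Set.subset_iInter h)⟩
  rw [Function.iterate_succ]
  exact Set.range_comp_subset_range _ _

theorem stable_and_conjugate_of_nonempty {S : Type*} [Finite S] [Nonempty S] [Lattice S]
    (G : LatticeHom (ℤ → S) (ℤ → S)) {r : ℕ} (hr : HasRadius1 Set.univ G r)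
    (hs : ∀ x, G (shiftMap x) = shiftMap (G x)) :
    ∃ q : ℕ,
      Set.range (G^[q + 1]) = Set.range (G^[q]) ∧
      (⋂ n : ℕ, Set.range (G^[n])) = Set.range (G^[q]) ∧
      ∃ (m : ℕ) (R : Fin m → Type) (_ : ∀ l, Fintype (R l)) (iL : ∀ l, Lattice (R l))
        (k : Fin m → ℤ) (p : ℕ), 0 < p ∧
        @LimitConjugacyData S _ (⋂ n : ℕ, Set.range (G^[n])) G m R iL k p := by
  have := Fintype.ofFinite S
  let _ : BoundedOrder S := Fintype.toBoundedOrder S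
  have hGs : ∀ n x, G.iterate n (shiftMap x) = shiftMap (G.iterate n x) := fun n x =>
    (Function.Commute.iterate_left (f := G) (g := shiftMap) hs n) x
  have hGr : ∀ n, HasRadius1 Set.univ (G.iterate n) (n * r) := hasRadius1_iterate hr
  obtain ⟨q, hq⟩ := exists_iterate_ker_stable G
  let single : LatticeHom S (ℤ → S) :=
    { toFun := fun a => G.iterate q (Function.update ⊥ 0 a)
      map_sup' := fun a b => by
        rw [← map_sup, ← Function.update_sup]
      map_inf' := fun a b => by
        change G.iterate q _ = G.iterate q _ ⊓ G.iterate q _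
        rw [← map_inf, ← Function.update_inf] }
  obtain ⟨m, R, _, P, hfin, hnon, hind, hPs, hP⟩ :=
    exists_surjective_hom_pi_directlyIndecomposable single
  replace hP : ∀ a b, P a = P b ↔
    G.iterate q (Function.update ⊥ 0 a) = G.iterate q (Function.update ⊥ 0 b) := hP
  obtain ⟨s, hsP⟩ := hPs.hasRightInverse
  have hlift : ∀ t : ℤ → ∀ l, R l, ∃ x : ℤ → S, (fun i => P (x i)) = t := fun t =>
    ⟨fun i => s (t i), funext fun i => hsP _⟩
  have hqs : ∀ x : ℤ → S, G.iterate q (fun i => s (P (x i))) = G.iterate q x := fun x =>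
    map_eq_of_forall_update (hGr q) (hGs q) fun i => (hP _ _).1 (hsP _)
  have hGP : ∀ x y : ℤ → S, G.iterate q x = G.iterate q y → (fun i => P (x i)) = fun i => P (y i) :=
    fun x y h => funext fun i => (hP _ _).2
      (map_update_eq_of_forall_eq (hGr q) (hGs q) fun j _ => congrFun h j)
  have hcomm : ∀ x, G.iterate q (G x) = G (G.iterate q x) := fun x =>
    Function.Commute.iterate_self G q x
  have hFP : ∀ x : ℤ → S, (fun i => P (G (fun j => s (P (x j))) i)) = fun i => P (G x i) := fun x =>
    hGP _ _ (by rw [hcomm, hcomm, hqs])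
  let F : LatticeHom (ℤ → ∀ l, R l) (ℤ → ∀ l, R l) :=
    { toFun := fun t i => P (G (fun j => s (t j)) i)
      map_sup' := fun t t' => by
        obtain ⟨x, rfl⟩ := hlift t
        obtain ⟨y, rfl⟩ := hlift t'
        have h : (fun i => P (x i)) ⊔ (fun i => P (y i)) = fun i => P ((x ⊔ y) i) :=
          funext fun i => (map_sup P _ _).symm
        rw [h, hFP, hFP, hFP, map_sup]
        exact funext fun i => map_sup P _ _
      map_inf' := fun t t' => by
        obtain ⟨x, rfl⟩ := hlift t
        obtain ⟨y, rfl⟩ := hlift t'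
        have h : (fun i => P (x i)) ⊓ (fun i => P (y i)) = fun i => P ((x ⊓ y) i) :=
          funext fun i => (map_inf P _ _).symm
        change (fun i => P (G (fun j => s (((fun i => P (x i)) ⊓ (fun i => P (y i))) j)) i)) =
          (fun i => P (G (fun j => s (P (x j))) i)) ⊓ (fun i => P (G (fun j => s (P (y j))) i))
        rw [h, hFP, hFP, hFP, map_inf]
        exact funext fun i => map_inf P _ _ }
  let Ψ : LatticeHom (ℤ → ∀ l, R l) (ℤ → S) :=
    { toFun := fun t => G.iterate q fun j => s (t j)
      map_sup' := fun t t' => by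
        obtain ⟨x, rfl⟩ := hlift t
        obtain ⟨y, rfl⟩ := hlift t'
        have h : (fun i => P (x i)) ⊔ (fun i => P (y i)) = fun i => P ((x ⊔ y) i) :=
          funext fun i => (map_sup P _ _).symm
        rw [h, hqs, hqs, hqs, map_sup]
      map_inf' := fun t t' => by
        obtain ⟨x, rfl⟩ := hlift t
        obtain ⟨y, rfl⟩ := hlift t'
        have h : (fun i => P (x i)) ⊓ (fun i => P (y i)) = fun i => P ((x ⊓ y) i) :=
          funext fun i => (map_inf P _ _).symm
        change (G.iterate q fun j => s (((fun i => P (x i)) ⊓ (fun i => P (y i))) j)) =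
          (G.iterate q fun j => s (P (x j))) ⊓ G.iterate q fun j => s (P (y j))
        rw [h, hqs, hqs, hqs, map_inf] }
  have hF : ∀ x : ℤ → S, F (fun i => P (x i)) = fun i => P (G x i) := hFP
  have hΨ : ∀ x : ℤ → S, Ψ (fun i => P (x i)) = G.iterate q x := hqs
  have hΨF : Function.Semiconj Ψ F G := fun t => by
    obtain ⟨x, rfl⟩ := hlift t
    rw [hF, hΨ, hΨ, hcomm]
  have hΨrange : Set.range Ψ = Set.range G^[q] := by
    refine Set.Subset.antisymm ?_ ?_
    · rintro _ ⟨t, rfl⟩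
      exact ⟨_, rfl⟩
    · rintro _ ⟨x, rfl⟩
      exact ⟨_, hΨ x⟩
  have hFinj : Function.Injective F := fun t t' h => by
    obtain ⟨x, rfl⟩ := hlift t
    obtain ⟨y, rfl⟩ := hlift t'
    have h' : G.iterate (q + 1) x = G.iterate (q + 1) y := by
      have h2 := congrArg Ψ h
      rwa [hF, hF, hΨ, hΨ] at h2
    exact funext fun i => (hP _ _).2 (hq _ _
      (map_update_eq_of_forall_eq (hGr (q + 1)) (hGs (q + 1)) fun j _ => congrFun h' j))
  have hFr : HasRadius1 Set.univ F r := fun t _ t' _ i h =>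
    congrArg P (hr _ trivial _ trivial i fun j hj => congrArg s (h j hj))
  have hFs : ∀ t, F (shiftMap t) = shiftMap (F t) := fun t =>
    congrArg (fun x i => P (x i)) (hs fun j => s (t j))
  obtain ⟨k, p, hp, hFp⟩ := exists_iterate_eq_shift hind F hFr hFs hFinj
  have hFsurj : Function.Surjective F := by
    obtain ⟨p, rfl⟩ := Nat.exists_eq_succ_of_ne_zero hp.ne'
    refine Function.Surjective.of_comp (g := F^[p]) ?_
    rw [← Function.iterate_succ']
    exact fun t => ⟨fun n l => t (n - k l) l, by simp [hFp]⟩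
  have hsub : ∀ n, Set.range G^[q] ⊆ Set.range G^[n] := fun n => by
    rw [← hΨrange]
    rintro _ ⟨t, rfl⟩
    obtain ⟨t, rfl⟩ := hFsurj.iterate n t
    exact ⟨Ψ t, (hΨF.iterate_right n t).symm⟩
  obtain ⟨h1, h2⟩ := iInter_range_iterate_eq hsub
  refine ⟨q, h1, h2, m, R, fun l => Fintype.ofFinite _, inferInstance, k, p, hp, ?_⟩
  rw [h2, ← hΨrange]
  refine limitConjugacyData_of_semiconj (r := q * r) hΨF ?_ ?_ ?_ hFp
  · exact fun t _ t' _ i h => hGr q _ trivial _ trivial i fun j hj => congrArg s (h j hj)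
  · exact fun t => hGs q fun j => s (t j)
  · intro t t' i h
    rw [← hsP (t i), ← hsP (t' i)]
    exact (hP _ _).2 (map_update_eq_of_forall_eq (hGr q) (hGs q) h)

/-- Theorem: a lattice-linear cellular automaton `G` on `S^ℤ` (a block map which is a
lattice homomorphism for the cellwise operations) is stable, its limit set is reached
in `q` steps and is algebraically conjugate to a product of full shifts over finite
lattices, and some power `G^p` acts on the limit set as a product of powers of shift
maps. -/
theorem stmt18 {S : Type*} [Fintype S] [Lattice S]
    (G : (ℤ → S) → (ℤ → S))
    (hrad : ∃ r : ℕ, HasRadius1 Set.univ G r)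
    (hshift : ∀ x : ℤ → S, G (shiftMap x) = shiftMap (G x))
    (hmeet : ∀ x y : ℤ → S, G (fun i => x i ⊓ y i) = fun i => G x i ⊓ G y i)
    (hjoin : ∀ x y : ℤ → S, G (fun i => x i ⊔ y i) = fun i => G x i ⊔ G y i) :
    ∃ q : ℕ,
      Set.range (G^[q + 1]) = Set.range (G^[q]) ∧
      (⋂ n : ℕ, Set.range (G^[n])) = Set.range (G^[q]) ∧
      ∃ (m : ℕ) (R : Fin m → Type) (_ : ∀ l, Fintype (R l)) (iL : ∀ l, Lattice (R l))
        (k : Fin m → ℤ) (p : ℕ), 0 < p ∧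
        @LimitConjugacyData S _ (⋂ n : ℕ, Set.range (G^[n])) G m R iL k p := by
  rcases isEmpty_or_nonempty S with hS | hS
  · exact stable_and_conjugate_of_isEmpty G
  obtain ⟨r, hr⟩ := hrad
  exact stable_and_conjugate_of_nonempty
    { toFun := G, map_sup' := hjoin, map_inf' := hmeet } hr hshift
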